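/- Let m ≥ 1 and ν ≥ 1 be integers and fix φ ∈ C^∞(ℝ^m, ℝ) with support in the open unit ball and ∫_{ℝ^m} φ = 1. There exist constants η ∈ (0,1) and C ∈ (0,∞), depending only on m and φ, such that for every δ ∈ (0,∞), every λ ∈ [2,∞), every nonempty set Y ⊆ ℝ^ν and every bounded Borel measurable u : ℝ^m → ℝ^ν with u(x) ∈ Y for Lebesgue-almost every x ∈ ℝ^m, the extension by averaging V of u satisfies ∫_1^λ Σ_{k∈ℤ} ∫_{[0,1]^m} card{ j ∈ ℤ^m : sup_{x ∈ ∂Q^+_{λ,τ,k,h,j}} dist(V(x), Y) ≥ δ } dh (dτ/τ) ≤ (C/δ^{m+1}) · ∬_{ℝ^m×ℝ^m} (|u(y)−u(z)| − ηδ)_+^{m+1} / |y−z|^{2m} dy dz. -/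

import Mathlib

open MeasureTheory Metric Set
open scoped ENNReal Topology

noncomputable section

abbrev Euc (m : ℕ) : Type := EuclideanSpace ℝ (Fin m)

/-- Truncated mean oscillation `MO_{δ,p} u (x', r)` of a map `u : ℝ^m → N`:
the double average over the ball of radius `r` centered at `x'` of
`(d(u y, u z) - δ)₊ ^ p`. -/
def MO {N : Type} [PseudoMetricSpace N] {m : ℕ} (p δ : ℝ) (u : Euc m → N)
    (x' : Euc m) (r : ℝ) : ℝ≥0∞ :=
  (volume (ball x' r))⁻¹ * (volume (ball x' r))⁻¹ *
    ∫⁻ y in ball x' r, ∫⁻ z in ball x' r,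
      ENNReal.ofReal (max (dist (u y) (u z) - δ) 0 ^ p)

/-- Truncated Gagliardo energy `∬ (d(u y, u z) - δ)₊^p / |y-z|^{2m}`. -/
def truncGagliardo {N : Type} [PseudoMetricSpace N] {m : ℕ} (p δ : ℝ)
    (u : Euc m → N) : ℝ≥0∞ :=
  ∫⁻ y, ∫⁻ z, ENNReal.ofReal (max (dist (u y) (u z) - δ) 0 ^ p) /
    ENNReal.ofReal (dist y z ^ (2 * m))

/-- The cube `r·([0,1]^m + c)` of edge length `r` in `ℝ^m`. -/
def cube (m : ℕ) (r : ℝ) (c : Fin m → ℝ) : Set (Euc m) :=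
  {x | ∀ i, x i ∈ Icc (r * c i) (r * (c i + 1))}

/-- The λ-adic cube `Q⁺_{λ,τ,k,h,j}` of the half-space `ℝ^m × (0,∞)`, with base
`τλ^{-k}([0,1]^m + c)` (where `c = j + h`) and height interval
`[τλ^{-k}/(λ-1), τλ^{-(k-1)}/(λ-1)]`. -/
def cubeQ (m : ℕ) (lam τ : ℝ) (k : ℤ) (c : Fin m → ℝ) : Set (Euc m × ℝ) :=
  cube m (τ * lam ^ (-k)) c ×ˢ
    Icc (τ * lam ^ (-k) / (lam - 1)) (τ * lam ^ (-(k - 1)) / (lam - 1))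

/-- Extension by averaging: `V(x', x_{m+1}) = ∫ u(x' - x_{m+1} z) φ(z) dz`. -/
def avgExt {m ν : ℕ} (φ : Euc m → ℝ) (u : Euc m → Euc ν) (x : Euc m × ℝ) : Euc ν :=
  ∫ z, φ z • u (x.1 - x.2 • z)

/-- Affine change of variables `z ↦ x - t • z`. -/
theorem lintegral_comp_sub_smul {m : ℕ} (f : Euc m → ℝ≥0∞) (hf : Measurable f) (x : Euc m)
    {t : ℝ} (ht : 0 < t) :
    ∫⁻ z, f (x - t • z) = ENNReal.ofReal ((t ^ m)⁻¹) * ∫⁻ z, f z := by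
  have h1 : ∫⁻ z, f (x - t • z) = ∫⁻ w, f (x - w) ∂(Measure.map (t • ·) volume) := by
    rw [lintegral_map (by fun_prop) (measurable_const_smul t)]
  rw [h1, Measure.map_addHaar_smul volume ht.ne', lintegral_smul_measure,
    lintegral_sub_left_eq_self f x]
  simp [abs_of_pos ht]

theorem setLIntegral_ball_comp_sub_smul {m : ℕ} (f : Euc m → ℝ≥0∞) (hf : Measurable f)
    (x : Euc m) {t : ℝ} (ht : 0 < t) :
    ∫⁻ z in ball 0 1, f (x - t • z)
      = ENNReal.ofReal ((t ^ m)⁻¹) * ∫⁻ z in ball x t, f z := by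
  rw [← lintegral_indicator measurableSet_ball, ← lintegral_indicator measurableSet_ball,
    ← lintegral_comp_sub_smul _ (hf.indicator measurableSet_ball) x ht]
  congr 1
  ext z
  have : z ∈ ball (0 : Euc m) 1 ↔ x - t • z ∈ ball x t := by
    rw [mem_ball_zero_iff, mem_ball_iff_norm, sub_sub_cancel_left, norm_neg, norm_smul,
      Real.norm_of_nonneg ht.le]
    constructor <;> intro h <;> nlinarith
  by_cases hz : z ∈ ball (0 : Euc m) 1
  · rw [indicator_of_mem hz, indicator_of_mem (this.1 hz)]
  · rw [indicator_of_notMem hz, indicator_of_notMem (fun h => hz (this.2 h))]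

/-- The averages of `u` are compared with any vector `q` through the mean deviation. -/
theorem enorm_avgExt_sub_le {m ν : ℕ} {φ : Euc m → ℝ} (hφ : Integrable φ) {A : ℝ}
    (hA : ∀ z, |φ z| ≤ A) (hsupp : tsupport φ ⊆ ball 0 1) (hint : ∫ z, φ z = 1)
    {u : Euc m → Euc ν} (hu : Measurable u) {M : ℝ} (hM : ∀ x, ‖u x‖ ≤ M)
    (x : Euc m × ℝ) (q : Euc ν) :
    ‖avgExt φ u x - q‖ₑ ≤
      ENNReal.ofReal A * ∫⁻ z in ball (0 : Euc m) 1, ‖u (x.1 - x.2 • z) - q‖ₑ := by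
  have hmeas : Measurable fun z => u (x.1 - x.2 • z) := by fun_prop
  have h1 : Integrable fun z => φ z • u (x.1 - x.2 • z) :=
    hφ.smul_bdd M hmeas.aestronglyMeasurable (ae_of_all _ fun z => hM _)
  have h2 : avgExt φ u x - q = ∫ z, φ z • (u (x.1 - x.2 • z) - q) := by
    simp_rw [smul_sub]
    rw [integral_sub h1 (hφ.smul_const q), integral_smul_const, hint, one_smul]
    rfl
  rw [h2, ← lintegral_const_mul _ (by fun_prop), ← lintegral_indicator measurableSet_ball]
  refine (enorm_integral_le_lintegral_enorm _).trans (lintegral_mono fun z => ?_)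
  by_cases hz : z ∈ ball (0 : Euc m) 1
  · rw [indicator_of_mem hz, enorm_smul]
    gcongr
    rw [Real.enorm_eq_ofReal_abs]
    exact ENNReal.ofReal_le_ofReal (hA z)
  · have : φ z = 0 := image_eq_zero_of_notMem_tsupport fun h => hz (hsupp h)
    simp [this]

theorem le_add_truncated_pow {s a : ℝ} (ha : 0 < a) (m : ℕ) :
    s ≤ 2 * a + (a ^ m)⁻¹ * max (s - a) 0 ^ ((m : ℝ) + 1) := by
  have hp : max (s - a) 0 ^ ((m : ℝ) + 1) = max (s - a) 0 ^ (m + 1) := by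
    rw [← Real.rpow_natCast]; push_cast; rfl
  rw [hp]
  rcases le_or_gt s (2 * a) with h | h
  · have : 0 ≤ (a ^ m)⁻¹ * max (s - a) 0 ^ (m + 1) := by positivity
    linarith
  · rw [max_eq_left (by linarith)]
    have h1 : a ^ m ≤ (s - a) ^ m := pow_le_pow_left₀ ha.le (by linarith) m
    have h2 : s - a ≤ (a ^ m)⁻¹ * (s - a) ^ (m + 1) := by
      rw [inv_mul_eq_div, le_div_iff₀ (by positivity), pow_succ, mul_comm]
      exact mul_le_mul_of_nonneg_right h1 (by linarith)
    linarith

/-- If the average extension is far from `Y` at a point, then the truncated mean oscillation of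
`u` is large on the corresponding ball. -/
theorem exists_oscillation_bound {m : ℕ} {φ : Euc m → ℝ} (hφ : Integrable φ) {A : ℝ}
    (hA0 : 0 < A) (hA : ∀ z, |φ z| ≤ A) (hsupp : tsupport φ ⊆ ball 0 1) (hint : ∫ z, φ z = 1) :
    ∃ η : ℝ, η ∈ Ioo (0 : ℝ) 1 ∧ ∃ C : ℝ, 0 < C ∧
      ∀ (ν : ℕ) (δ : ℝ), 0 < δ → ∀ (Y : Set (Euc ν)) (u : Euc m → Euc ν), Measurable u →
        (∃ M : ℝ, ∀ x, ‖u x‖ ≤ M) → (∀ᵐ x, u x ∈ Y) → ∀ x : Euc m, ∀ t : ℝ, 0 < t →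
        δ / 2 < infDist (avgExt φ u (x, t)) Y →
        ENNReal.ofReal (δ ^ (m + 1)) ≤ ENNReal.ofReal C * (ENNReal.ofReal ((t ^ (2 * m))⁻¹) *
          ∫⁻ y in ball x t, ∫⁻ z in ball x t,
            ENNReal.ofReal (max (dist (u y) (u z) - η * δ) 0 ^ ((m : ℝ) + 1))) := by
  set v : ℝ := (volume (ball (0 : Euc m) 1)).toReal with hv
  have hvtop : volume (ball (0 : Euc m) 1) ≠ ⊤ := measure_ball_lt_top.ne
  have hv0 : 0 < v := ENNReal.toReal_pos (measure_ball_pos _ _ one_pos).ne' hvtop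
  have hvv : volume (ball (0 : Euc m) 1) = ENNReal.ofReal v := (ENNReal.ofReal_toReal hvtop).symm
  obtain ⟨η, hη0, hη1, hη⟩ : ∃ η : ℝ, 0 < η ∧ η < 1 ∧ 8 * A * v * η ≤ 1 := by
    refine ⟨min (1 / 2) (1 / (8 * A * v)), by positivity,
      (min_le_left _ _).trans_lt (by norm_num), ?_⟩
    calc 8 * A * v * min (1 / 2) (1 / (8 * A * v)) ≤ 8 * A * v * (1 / (8 * A * v)) := by
          gcongr; exact min_le_right _ _
      _ = 1 := by field_simp
  refine ⟨η, ⟨hη0, hη1⟩, 4 * A / η ^ m / v, by positivity, ?_⟩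
  rintro ν δ hδ Y u hu ⟨M, hM⟩ hY x t ht hbad
  set p : ℝ := (m : ℝ) + 1
  have hF : Measurable fun X : Euc m × Euc m =>
      ENNReal.ofReal (max (dist (u X.1) (u X.2) - η * δ) 0 ^ p) := by fun_prop
  have key : ∀ q ∈ Y, ENNReal.ofReal (δ ^ (m + 1)) ≤ ENNReal.ofReal (4 * A / η ^ m) *
      (ENNReal.ofReal ((t ^ m)⁻¹) *
        ∫⁻ z in ball x t, ENNReal.ofReal (max (dist q (u z) - η * δ) 0 ^ p)) := by
    intro q hq
    have hFq : Measurable fun z => ENNReal.ofReal (max (dist q (u z) - η * δ) 0 ^ p) := by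
      fun_prop
    rw [← setLIntegral_ball_comp_sub_smul _ hFq x ht]
    set I := ∫⁻ z in ball (0 : Euc m) 1,
      ENNReal.ofReal (max (dist q (u (x - t • z)) - η * δ) 0 ^ p) with hI
    have h1 : ENNReal.ofReal (δ / 2) ≤ ENNReal.ofReal A *
        (ENNReal.ofReal (2 * (η * δ)) * ENNReal.ofReal v
          + ENNReal.ofReal (((η * δ) ^ m)⁻¹) * I) := by
      calc ENNReal.ofReal (δ / 2) ≤ ‖avgExt φ u (x, t) - q‖ₑ := by
            rw [← ofReal_norm, ← dist_eq_norm]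
            exact ENNReal.ofReal_le_ofReal (hbad.le.trans (infDist_le_dist_of_mem hq))
        _ ≤ _ := enorm_avgExt_sub_le hφ hA hsupp hint hu hM (x, t) q
        _ ≤ _ := by
            gcongr
            rw [← hvv, mul_comm (ENNReal.ofReal (2 * (η * δ))), hI,
              ← lintegral_const_mul _ (by fun_prop), mul_comm, ← setLIntegral_const,
              ← lintegral_add_left measurable_const]
            refine lintegral_mono fun z => ?_
            rw [← ofReal_norm, ← dist_eq_norm, dist_comm,
              ← ENNReal.ofReal_mul (by positivity),
              ← ENNReal.ofReal_add (by positivity) (by positivity)]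
            exact ENNReal.ofReal_le_ofReal (le_add_truncated_pow (by positivity) m)
    rcases eq_or_ne I ⊤ with hItop | hItop
    · rw [hItop, ENNReal.mul_top]
      · exact le_top
      · rw [Ne, ENNReal.ofReal_eq_zero, not_le]; positivity
    rw [← ENNReal.ofReal_toReal hItop] at h1 ⊢
    have hJ : 0 ≤ I.toReal := ENNReal.toReal_nonneg
    generalize I.toReal = J at h1 hJ ⊢
    rw [← ENNReal.ofReal_mul (by positivity), ← ENNReal.ofReal_mul (by positivity),
      ← ENNReal.ofReal_add (by positivity) (by positivity), ← ENNReal.ofReal_mul (by positivity),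
      ENNReal.ofReal_le_ofReal_iff (by positivity)] at h1
    rw [← ENNReal.ofReal_mul (by positivity)]
    refine ENNReal.ofReal_le_ofReal ?_
    have h2 : δ / 4 ≤ A * (((η * δ) ^ m)⁻¹ * J) := by nlinarith
    have h3 : δ / 4 * (η * δ) ^ m ≤ A * J := by
      calc _ ≤ A * (((η * δ) ^ m)⁻¹ * J) * (η * δ) ^ m := by gcongr
        _ = A * J := by field_simp
    rw [mul_pow] at h3
    rw [div_mul_eq_mul_div, le_div_iff₀ (by positivity)]
    calc _ = 4 * (δ / 4 * (η ^ m * δ ^ m)) := by ring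
      _ ≤ 4 * (A * J) := by gcongr
      _ = _ := by ring
  have hball : volume (ball x t) = ENNReal.ofReal (t ^ m * v) := by
    rw [Measure.addHaar_ball_of_pos _ _ ht, hvv, ENNReal.ofReal_mul (by positivity)]
    simp
  have hsum : ENNReal.ofReal (δ ^ (m + 1)) * volume (ball x t) ≤
      ENNReal.ofReal (4 * A / η ^ m) * (ENNReal.ofReal ((t ^ m)⁻¹) *
        ∫⁻ y in ball x t, ∫⁻ z in ball x t,
          ENNReal.ofReal (max (dist (u y) (u z) - η * δ) 0 ^ p)) := by
    have hG : Measurable fun y => ∫⁻ z in ball x t,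
        ENNReal.ofReal (max (dist (u y) (u z) - η * δ) 0 ^ p) := hF.lintegral_prod_right'
    rw [← lintegral_const_mul _ hG, ← lintegral_const_mul _ (by fun_prop), ← setLIntegral_const]
    refine lintegral_mono_ae (ae_restrict_of_ae ?_)
    filter_upwards [hY] with y hy using key _ hy
  set B := ∫⁻ y in ball x t, ∫⁻ z in ball x t,
          ENNReal.ofReal (max (dist (u y) (u z) - η * δ) 0 ^ p)
  calc ENNReal.ofReal (δ ^ (m + 1))
      = ENNReal.ofReal (δ ^ (m + 1)) * volume (ball x t) * ENNReal.ofReal ((t ^ m * v)⁻¹) := by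
        rw [hball, mul_assoc, ← ENNReal.ofReal_mul (by positivity),
          mul_inv_cancel₀ (by positivity), ENNReal.ofReal_one, mul_one]
    _ ≤ ENNReal.ofReal (4 * A / η ^ m) * (ENNReal.ofReal ((t ^ m)⁻¹) * B)
          * ENNReal.ofReal ((t ^ m * v)⁻¹) := by gcongr
    _ = (ENNReal.ofReal (4 * A / η ^ m) * ENNReal.ofReal ((t ^ m)⁻¹)
          * ENNReal.ofReal ((t ^ m * v)⁻¹)) * B := by ring
    _ = _ := by
        rw [← mul_assoc]
        congr 1
        rw [← ENNReal.ofReal_mul (by positivity), ← ENNReal.ofReal_mul (by positivity),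
          ← ENNReal.ofReal_mul (by positivity)]
        congr 1
        field_simp
        ring

/-- Kernel controlling the horizontal faces, at height `a * r`. -/
def horizontalKernel {m : ℕ} (a r : ℝ) (c : Fin m → ℝ) (y z : Euc m) : ℝ≥0∞ :=
  Set.indicator {X : ℝ × (Fin m → ℝ) × Euc m × Euc m |
      dist X.2.2.1 X.2.2.2 < 2 * (a * X.1) ∧ ∀ l, |X.2.2.1 l - X.1 * X.2.1 l| ≤ 3 * X.1}
    (fun X => ENNReal.ofReal (((a * X.1) ^ (2 * m))⁻¹)) (r, c, y, z)

/-- Kernel controlling the lateral faces orthogonal to the `i`-th direction. -/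
def lateralKernel {m : ℕ} (i : Fin m) (e r : ℝ) (c : Fin m → ℝ) (y z : Euc m) : ℝ≥0∞ :=
  Set.indicator {X : ℝ × (Fin m → ℝ) × Euc m × Euc m |
      dist X.2.2.1 X.2.2.2 < 4 * X.1 ∧ ∀ l, |X.2.2.1 l - X.1 * X.2.1 l| ≤ 3 * X.1}
    (fun X => ENNReal.ofReal ((2 / dist X.2.2.1 X.2.2.2) ^ (2 * (m - 1)) *
      (5 / (dist X.2.2.1 X.2.2.2 ^ 2 + (X.2.2.1 i - X.1 * (X.2.1 i + e)) ^ 2)))) (r, c, y, z)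

theorem measurable_horizontalKernel {m : ℕ} (a : ℝ) :
    Measurable fun X : (ℝ × (Fin m → ℝ)) × Euc m × Euc m =>
      horizontalKernel a X.1.1 X.1.2 X.2.1 X.2.2 := by
  have h : Measurable fun X : (ℝ × (Fin m → ℝ)) × Euc m × Euc m =>
      (X.1.1, X.1.2, X.2.1, X.2.2) := by fun_prop
  refine (Measurable.indicator (by fun_prop) ?_).comp h
  rw [ofPred_and, ofPred_forall]
  refine MeasurableSet.inter (measurableSet_lt (by fun_prop) (by fun_prop)) ?_
  exact MeasurableSet.iInter fun l => measurableSet_le (by fun_prop) (by fun_prop)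

theorem measurable_lateralKernel {m : ℕ} (i : Fin m) (e : ℝ) :
    Measurable fun X : (ℝ × (Fin m → ℝ)) × Euc m × Euc m =>
      lateralKernel i e X.1.1 X.1.2 X.2.1 X.2.2 := by
  have h : Measurable fun X : (ℝ × (Fin m → ℝ)) × Euc m × Euc m =>
      (X.1.1, X.1.2, X.2.1, X.2.2) := by fun_prop
  refine (Measurable.indicator (by fun_prop) ?_).comp h
  rw [ofPred_and, ofPred_forall]
  refine MeasurableSet.inter (measurableSet_lt (by fun_prop) (by fun_prop)) ?_
  exact MeasurableSet.iInter fun l => measurableSet_le (by fun_prop) (by fun_prop)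

/-- Integral of a power on a half-line. -/
theorem lintegral_Ioi_inv_pow {n : ℕ} (hn : 1 ≤ n) {R : ℝ} (hR : 0 < R) :
    ∫⁻ r in Ioi R, ENNReal.ofReal ((r ^ (n + 1))⁻¹) ≤ ENNReal.ofReal ((R ^ n)⁻¹) := by
  have hn' : (1 : ℝ) ≤ n := by exact_mod_cast hn
  have hlt : -((n : ℝ) + 1) < -1 := by linarith
  have hi := integrableOn_Ioi_rpow_of_lt hlt hR
  have hcongr : ∀ r ∈ Ioi R, ENNReal.ofReal ((r ^ (n + 1))⁻¹)
      = ENNReal.ofReal (r ^ (-((n : ℝ) + 1))) := by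
    intro r hr
    have hr0 : 0 < r := hR.trans hr
    rw [Real.rpow_neg hr0.le]
    congr 2
    rw [← Real.rpow_natCast]; push_cast; rfl
  rw [setLIntegral_congr_fun measurableSet_Ioi hcongr, ← ofReal_integral_eq_lintegral_ofReal hi,
    integral_Ioi_rpow_of_lt hlt hR]
  · refine ENNReal.ofReal_le_ofReal ?_
    have h1 : -((n : ℝ) + 1) + 1 = -(n : ℝ) := by ring
    rw [h1, Real.rpow_neg hR.le, Real.rpow_natCast, neg_div_neg_eq]
    exact div_le_self (by positivity) hn'
  · refine (ae_restrict_iff' measurableSet_Ioi).2 (ae_of_all _ fun r hr => ?_)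
    exact Real.rpow_nonneg (hR.trans hr).le _

theorem setOf_abs_sub_mul_le {r : ℝ} (hr : 0 < r) (y : ℝ) :
    {c : ℝ | |y - r * c| ≤ 3 * r} = Icc (y / r - 3) (y / r + 3) := by
  have hy : y = y / r * r := by field_simp
  ext c
  rw [mem_ofPred_eq, mem_Icc, abs_le]
  constructor <;> rintro ⟨h1, h2⟩ <;> constructor <;> nlinarith

theorem volume_setOf_forall_abs_sub_mul_le {m : ℕ} {r : ℝ} (hr : 0 < r) (y : Fin m → ℝ) :
    volume {c : Fin m → ℝ | ∀ l, |y l - r * c l| ≤ 3 * r} = ENNReal.ofReal (6 ^ m) := by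
  have : {c : Fin m → ℝ | ∀ l, |y l - r * c l| ≤ 3 * r}
      = Set.pi univ fun l => Icc (y l / r - 3) (y l / r + 3) := by
    ext c
    simp only [mem_ofPred_eq, mem_univ_pi, ← setOf_abs_sub_mul_le hr]
  rw [this, volume_pi_pi]
  simp only [Real.volume_Icc, add_sub_sub_cancel]
  norm_num [ENNReal.ofReal_pow]

theorem integrable_inv_sq_add_sq {ρ r : ℝ} (hρ : 0 < ρ) (hr : 0 < r) (b : ℝ) :
    Integrable (fun c : ℝ => (ρ ^ 2 + (b - r * c) ^ 2)⁻¹) ∧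
      ∫ c : ℝ, (ρ ^ 2 + (b - r * c) ^ 2)⁻¹ = Real.pi / (ρ * r) := by
  have h : (fun c : ℝ => (ρ ^ 2 + (b - r * c) ^ 2)⁻¹)
      = fun c => (ρ ^ 2)⁻¹ * (fun x : ℝ => (1 + (b / ρ - x) ^ 2)⁻¹) ((r / ρ) * c) := by
    ext c
    rw [← mul_inv]
    congr 1
    field_simp
  have hne : r / ρ ≠ 0 := by positivity
  have hi : Integrable fun x : ℝ => (1 + (b / ρ - x) ^ 2)⁻¹ :=
    integrable_inv_one_add_sq.comp_sub_left (b / ρ)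
  rw [h]
  refine ⟨(hi.comp_mul_left' hne).const_mul _, ?_⟩
  rw [integral_const_mul, Measure.integral_comp_mul_left (fun x : ℝ => (1 + (b / ρ - x) ^ 2)⁻¹),
    integral_sub_left_eq_self (fun x : ℝ => (1 + x ^ 2)⁻¹) volume (b / ρ),
    integral_univ_inv_one_add_sq, abs_of_pos (by positivity), smul_eq_mul]
  field_simp

theorem lintegral_lateral_weight_le {m : ℕ} (i : Fin m) {ρ r : ℝ} (hρ : 0 < ρ) (hr : 0 < r)
    (e : ℝ) (y : Fin m → ℝ) :
    ∫⁻ c : Fin m → ℝ, Set.indicator {c : Fin m → ℝ | ∀ l, |y l - r * c l| ≤ 3 * r}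
        (fun c => ENNReal.ofReal ((ρ ^ 2 + (y i - r * (c i + e)) ^ 2)⁻¹)) c
      ≤ ENNReal.ofReal (6 ^ (m - 1) * (Real.pi / (ρ * r))) := by
  classical
  let f : Fin m → ℝ → ℝ := fun l => if l = i then
      fun c => (ρ ^ 2 + (y i - r * e - r * c) ^ 2)⁻¹
    else Set.indicator (Icc (y l / r - 3) (y l / r + 3)) (fun _ => 1)
  have hf0 : ∀ l c, 0 ≤ f l c := by
    intro l c
    by_cases hl : l = i
    · simp only [f, hl, if_true]; positivity
    · simp only [f, hl, if_false]
      exact indicator_nonneg (fun _ _ => zero_le_one) _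
  have hfi : ∀ l, Integrable (f l) := by
    intro l
    by_cases hl : l = i
    · simp only [f, hl, if_true]; exact (integrable_inv_sq_add_sq hρ hr _).1
    · simp only [f, hl, if_false]
      exact (integrable_indicator_iff measurableSet_Icc).2
        (integrableOn_const (by simp [Real.volume_Icc]))
  have hfI : ∀ l, ∫ c, f l c = if l = i then Real.pi / (ρ * r) else 6 := by
    intro l
    by_cases hl : l = i
    · simp only [f, hl, if_true]; exact (integrable_inv_sq_add_sq hρ hr _).2
    · simp only [f, hl, if_false]
      rw [integral_indicator measurableSet_Icc]
      simp only [integral_const, smul_eq_mul, mul_one, measureReal_restrict_apply_univ,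
        Real.volume_real_Icc]
      ring_nf
      norm_num
  calc _ ≤ ∫⁻ c : Fin m → ℝ, ENNReal.ofReal (∏ l, f l (c l)) := by
        refine lintegral_mono fun c => ?_
        refine indicator_apply_le' (fun hc => ?_) fun _ => zero_le

        refine ENNReal.ofReal_le_ofReal (le_of_eq ?_)
        rw [← Finset.mul_prod_erase _ _ (Finset.mem_univ i), Finset.prod_eq_one]
        · simp only [f, if_true, mul_one]
          congr 3
          ring
        · intro l hl
          have hc' : c l ∈ Icc (y l / r - 3) (y l / r + 3) := by
            rw [← setOf_abs_sub_mul_le hr]; exact hc l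
          simp only [f, Finset.ne_of_mem_erase hl, if_false, indicator_of_mem hc']
    _ = ENNReal.ofReal (∏ l, ∫ c, f l c) := by
        rw [volume_pi, ← ofReal_integral_eq_lintegral_ofReal (Integrable.fintype_prod_dep hfi)
          (ae_of_all _ fun c => Finset.prod_nonneg fun l _ => hf0 l _),
          integral_fintype_prod_eq_prod]
    _ = _ := by
        simp_rw [hfI]
        rw [← Finset.mul_prod_erase _ _ (Finset.mem_univ i),
          Finset.prod_congr rfl (g := fun _ => (6 : ℝ))]
        · simp [mul_comm, Finset.card_erase_of_mem]
        · intro l hl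
          simp [Finset.ne_of_mem_erase hl]

theorem horizontalKernel_of_mem {m : ℕ} {a r : ℝ} {c : Fin m → ℝ} {y z : Euc m}
    (h : dist y z < 2 * (a * r) ∧ ∀ l, |y l - r * c l| ≤ 3 * r) :
    horizontalKernel a r c y z = ENNReal.ofReal (((a * r) ^ (2 * m))⁻¹) := by
  unfold horizontalKernel
  rw [indicator_apply, if_pos (by exact h)]

theorem horizontalKernel_of_notMem {m : ℕ} {a r : ℝ} {c : Fin m → ℝ} {y z : Euc m}
    (h : ¬(dist y z < 2 * (a * r) ∧ ∀ l, |y l - r * c l| ≤ 3 * r)) :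
    horizontalKernel a r c y z = 0 := by
  unfold horizontalKernel
  rw [indicator_apply, if_neg (by exact h)]

theorem lateralKernel_of_mem {m : ℕ} {i : Fin m} {e r : ℝ} {c : Fin m → ℝ} {y z : Euc m}
    (h : dist y z < 4 * r ∧ ∀ l, |y l - r * c l| ≤ 3 * r) :
    lateralKernel i e r c y z = ENNReal.ofReal ((2 / dist y z) ^ (2 * (m - 1)) *
      (5 / (dist y z ^ 2 + (y i - r * (c i + e)) ^ 2))) := by
  unfold lateralKernel
  rw [indicator_apply, if_pos (by exact h)]

theorem lateralKernel_of_notMem {m : ℕ} {i : Fin m} {e r : ℝ} {c : Fin m → ℝ} {y z : Euc m}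
    (h : ¬(dist y z < 4 * r ∧ ∀ l, |y l - r * c l| ≤ 3 * r)) :
    lateralKernel i e r c y z = 0 := by
  unfold lateralKernel
  rw [indicator_apply, if_neg (by exact h)]

theorem lintegral_horizontalKernel_le {m : ℕ} (hm : 1 ≤ m) {a : ℝ} (ha : 0 < a) {y z : Euc m}
    (hyz : y ≠ z) :
    ∫⁻ r in Ioi (0 : ℝ), ∫⁻ c, horizontalKernel a r c y z * ENNReal.ofReal r⁻¹
      ≤ ENNReal.ofReal (6 ^ m * 4 ^ m * (dist y z ^ (2 * m))⁻¹) := by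
  have hρ : 0 < dist y z := dist_pos.2 hyz
  have hR : 0 < dist y z / (2 * a) := by positivity
  set ρ := dist y z with hρdef
  calc _ ≤ ∫⁻ r in Ioi (0 : ℝ), (Ioi (ρ / (2 * a))).indicator (fun r =>
          ENNReal.ofReal (6 ^ m * (a ^ (2 * m))⁻¹) * ENNReal.ofReal ((r ^ (2 * m + 1))⁻¹)) r := by
        refine setLIntegral_mono' measurableSet_Ioi fun r hr => ?_
        have hr0 : 0 < r := hr
        by_cases hrR : r ∈ Ioi (ρ / (2 * a))
        · rw [indicator_of_mem hrR]
          have hS : MeasurableSet {c : Fin m → ℝ | ∀ l, |y l - r * c l| ≤ 3 * r} := by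
            rw [ofPred_forall]
            exact MeasurableSet.iInter fun l => measurableSet_le (by fun_prop) (by fun_prop)
          calc _ ≤ ∫⁻ c, {c : Fin m → ℝ | ∀ l, |y l - r * c l| ≤ 3 * r}.indicator
                (fun _ => ENNReal.ofReal (((a * r) ^ (2 * m))⁻¹) * ENNReal.ofReal r⁻¹) c := by
                refine lintegral_mono fun c => ?_
                by_cases hc : ∀ l, |y l - r * c l| ≤ 3 * r
                · rw [indicator_of_mem (s := {c : Fin m → ℝ | ∀ l, |y l - r * c l| ≤ 3 * r}) hc]
                  exact mul_le_mul_left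
                    (indicator_apply_le' (fun _ => le_rfl) fun _ => zero_le) _
                · rw [horizontalKernel_of_notMem (fun h => hc h.2), zero_mul]
                  exact zero_le
            _ = _ := by
                rw [lintegral_indicator hS, setLIntegral_const,
                  volume_setOf_forall_abs_sub_mul_le hr0 y, ← ENNReal.ofReal_mul (by positivity),
                  ← ENNReal.ofReal_mul (by positivity), ← ENNReal.ofReal_mul (by positivity)]
                congr 1
                field_simp
                ring
        · rw [indicator_of_notMem hrR, nonpos_iff_eq_zero, lintegral_eq_zero_iff']
          · refine ae_of_all _ fun c => ?_
            change horizontalKernel _ _ _ _ _ * _ = 0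
            rw [horizontalKernel_of_notMem, zero_mul]
            · intro h
              have h1 : dist y z < 2 * (a * r) := h.1
              apply hrR
              rw [mem_Ioi, div_lt_iff₀ (by positivity), hρdef]
              linarith
          · exact (((measurable_horizontalKernel a).comp (f := fun c : Fin m → ℝ => ((r, c), y, z))
              (by fun_prop)).mul_const _).aemeasurable
    _ ≤ ∫⁻ r, (Ioi (ρ / (2 * a))).indicator (fun r =>
          ENNReal.ofReal (6 ^ m * (a ^ (2 * m))⁻¹) * ENNReal.ofReal ((r ^ (2 * m + 1))⁻¹)) r :=
        setLIntegral_le_lintegral _ _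
    _ ≤ ENNReal.ofReal (6 ^ m * (a ^ (2 * m))⁻¹)
          * ENNReal.ofReal (((ρ / (2 * a)) ^ (2 * m))⁻¹) := by
        rw [lintegral_indicator measurableSet_Ioi, lintegral_const_mul _ (by fun_prop)]
        gcongr
        exact lintegral_Ioi_inv_pow (by omega) hR
    _ = _ := by
        rw [← ENNReal.ofReal_mul (by positivity)]
        congr 1
        have h4 : (4 : ℝ) ^ m = 2 ^ (2 * m) := by rw [pow_mul]; norm_num
        rw [h4, div_pow, mul_pow]
        field_simp

theorem lintegral_lateralKernel_le {m : ℕ} (hm : 1 ≤ m) (i : Fin m) (e : ℝ) {y z : Euc m}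
    (hyz : y ≠ z) :
    ∫⁻ r in Ioi (0 : ℝ), ∫⁻ c, lateralKernel i e r c y z * ENNReal.ofReal r⁻¹
      ≤ ENNReal.ofReal (20 * Real.pi * 6 ^ (m - 1) * 2 ^ (2 * (m - 1))
        * (dist y z ^ (2 * m))⁻¹) := by
  have hρ : 0 < dist y z := dist_pos.2 hyz
  have hR : 0 < dist y z / 4 := by positivity
  have hpi := Real.pi_pos
  set ρ := dist y z with hρdef
  calc _ ≤ ∫⁻ r in Ioi (0 : ℝ), (Ioi (ρ / 4)).indicator (fun r =>
          ENNReal.ofReal ((2 / ρ) ^ (2 * (m - 1)) * 5 * 6 ^ (m - 1) * Real.pi / ρ)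
            * ENNReal.ofReal ((r ^ (1 + 1))⁻¹)) r := by
        refine setLIntegral_mono' measurableSet_Ioi fun r hr => ?_
        have hr0 : 0 < r := hr
        by_cases hrR : r ∈ Ioi (ρ / 4)
        · rw [indicator_of_mem hrR]
          have hS : MeasurableSet {c : Fin m → ℝ | ∀ l, |y l - r * c l| ≤ 3 * r} := by
            rw [ofPred_forall]
            exact MeasurableSet.iInter fun l => measurableSet_le (by fun_prop) (by fun_prop)
          calc _ ≤ ∫⁻ c, ENNReal.ofReal ((2 / ρ) ^ (2 * (m - 1)) * 5 * r⁻¹) *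
                {c : Fin m → ℝ | ∀ l, |y l - r * c l| ≤ 3 * r}.indicator
                (fun c => ENNReal.ofReal ((ρ ^ 2 + (y i - r * (c i + e)) ^ 2)⁻¹)) c := by
                refine lintegral_mono fun c => ?_
                by_cases hc : ∀ l, |y l - r * c l| ≤ 3 * r
                · rw [indicator_of_mem (s := {c : Fin m → ℝ | ∀ l, |y l - r * c l| ≤ 3 * r}) hc]
                  refine (mul_le_mul_left
                    (indicator_apply_le' (fun _ => le_rfl) fun _ => zero_le) _).trans ?_
                  rw [← ENNReal.ofReal_mul (by positivity), ← ENNReal.ofReal_mul (by positivity)]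
                  refine ENNReal.ofReal_le_ofReal (le_of_eq ?_)
                  simp only [← hρdef]
                  ring
                · rw [lateralKernel_of_notMem (fun h => hc h.2), zero_mul]
                  exact zero_le
            _ ≤ ENNReal.ofReal ((2 / ρ) ^ (2 * (m - 1)) * 5 * r⁻¹) *
                  ENNReal.ofReal (6 ^ (m - 1) * (Real.pi / (ρ * r))) := by
                rw [lintegral_const_mul _ (Measurable.indicator (by fun_prop) hS)]
                gcongr
                exact lintegral_lateral_weight_le i hρ hr0 e y
            _ = _ := by
                rw [← ENNReal.ofReal_mul (by positivity), ← ENNReal.ofReal_mul (by positivity)]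
                congr 1
                field_simp
        · rw [indicator_of_notMem hrR, nonpos_iff_eq_zero, lintegral_eq_zero_iff']
          · refine ae_of_all _ fun c => ?_
            change lateralKernel _ _ _ _ _ _ * _ = 0
            rw [lateralKernel_of_notMem, zero_mul]
            · intro h
              have h1 : dist y z < 4 * r := h.1
              apply hrR
              rw [mem_Ioi, div_lt_iff₀ (by positivity), hρdef]
              linarith
          · exact (((measurable_lateralKernel i e).comp (f := fun c : Fin m → ℝ => ((r, c), y, z))
              (by fun_prop)).mul_const _).aemeasurable
    _ ≤ ∫⁻ r, (Ioi (ρ / 4)).indicator (fun r =>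
          ENNReal.ofReal ((2 / ρ) ^ (2 * (m - 1)) * 5 * 6 ^ (m - 1) * Real.pi / ρ)
            * ENNReal.ofReal ((r ^ (1 + 1))⁻¹)) r :=
        setLIntegral_le_lintegral _ _
    _ ≤ ENNReal.ofReal ((2 / ρ) ^ (2 * (m - 1)) * 5 * 6 ^ (m - 1) * Real.pi / ρ)
          * ENNReal.ofReal (((ρ / 4) ^ 1)⁻¹) := by
        rw [lintegral_indicator measurableSet_Ioi, lintegral_const_mul _ (by fun_prop)]
        gcongr
        exact lintegral_Ioi_inv_pow le_rfl hR
    _ = _ := by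
        rw [← ENNReal.ofReal_mul (by positivity)]
        congr 1
        have h2 : ρ ^ (2 * m) = ρ ^ (2 * (m - 1)) * ρ ^ 2 := by
          rw [← pow_add]; congr 1; omega
        rw [h2, div_pow]
        field_simp
        ring

/-- Kernel controlling all faces of a cube of edge `r` and corner `r • c`. -/
def boundaryKernel {m : ℕ} (lam r : ℝ) (c : Fin m → ℝ) (y z : Euc m) : ℝ≥0∞ :=
  horizontalKernel (1 / (lam - 1)) r c y z + horizontalKernel (lam / (lam - 1)) r c y z
    + ∑ i, (lateralKernel i 0 r c y z + lateralKernel i 1 r c y z)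

theorem measurable_boundaryKernel {m : ℕ} (lam : ℝ) :
    Measurable fun X : (ℝ × (Fin m → ℝ)) × Euc m × Euc m =>
      boundaryKernel lam X.1.1 X.1.2 X.2.1 X.2.2 :=
  ((measurable_horizontalKernel _).add (measurable_horizontalKernel _)).add
    (Finset.measurable_fun_sum _ fun i _ =>
      (measurable_lateralKernel i 0).add (measurable_lateralKernel i 1))

theorem lintegral_boundaryKernel_le {m : ℕ} (hm : 1 ≤ m) {lam : ℝ} (hlam : 2 ≤ lam)
    {y z : Euc m} (hyz : y ≠ z) :
    ∫⁻ X, boundaryKernel lam X.1 X.2 y z * ENNReal.ofReal X.1⁻¹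
        ∂((volume.restrict (Ioi (0 : ℝ))).prod (volume : Measure (Fin m → ℝ)))
      ≤ ENNReal.ofReal (2 * (6 ^ m * 4 ^ m)
          + 2 * m * (20 * Real.pi * 6 ^ (m - 1) * 2 ^ (2 * (m - 1))))
        * ENNReal.ofReal ((dist y z ^ (2 * m))⁻¹) := by
  have hw : Measurable fun X : ℝ × (Fin m → ℝ) => ENNReal.ofReal X.1⁻¹ := by fun_prop
  have hsec : Measurable fun X : ℝ × (Fin m → ℝ) => (X, y, z) := by fun_prop
  have hmh : ∀ a, Measurable fun X : ℝ × (Fin m → ℝ) =>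
      horizontalKernel a X.1 X.2 y z * ENNReal.ofReal X.1⁻¹ := fun a =>
    ((measurable_horizontalKernel a).comp hsec).mul hw
  have hml : ∀ i e, Measurable fun X : ℝ × (Fin m → ℝ) =>
      lateralKernel i e X.1 X.2 y z * ENNReal.ofReal X.1⁻¹ := fun i e =>
    ((measurable_lateralKernel i e).comp hsec).mul hw
  have h1 : 0 < lam - 1 := by linarith
  have hpi := Real.pi_pos
  have hh : ∀ a, 0 < a → ∫⁻ X, horizontalKernel a X.1 X.2 y z * ENNReal.ofReal X.1⁻¹
      ∂((volume.restrict (Ioi (0 : ℝ))).prod (volume : Measure (Fin m → ℝ)))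
      ≤ ENNReal.ofReal (6 ^ m * 4 ^ m * (dist y z ^ (2 * m))⁻¹) := fun a ha => by
    rw [lintegral_prod _ (hmh a).aemeasurable]
    exact lintegral_horizontalKernel_le hm ha hyz
  have hl : ∀ i e, ∫⁻ X, lateralKernel i e X.1 X.2 y z * ENNReal.ofReal X.1⁻¹
      ∂((volume.restrict (Ioi (0 : ℝ))).prod (volume : Measure (Fin m → ℝ)))
      ≤ ENNReal.ofReal (20 * Real.pi * 6 ^ (m - 1) * 2 ^ (2 * (m - 1))
        * (dist y z ^ (2 * m))⁻¹) := fun i e => by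
    rw [lintegral_prod _ (hml i e).aemeasurable]
    exact lintegral_lateralKernel_le hm i e hyz
  simp only [boundaryKernel, add_mul, Finset.sum_mul]
  rw [lintegral_add_left (by exact (hmh _).add (hmh _)), lintegral_add_left (hmh _),
    lintegral_finsetSum _ (by exact fun i _ => (hml i 0).add (hml i 1))]
  simp_rw [lintegral_add_left (hml _ 0)]
  refine (add_le_add (add_le_add (hh _ (by positivity)) (hh _ (by positivity)))
    (Finset.sum_le_sum fun i _ => add_le_add (hl i 0) (hl i 1))).trans (le_of_eq ?_)
  rw [Finset.sum_const, Finset.card_univ, Fintype.card_fin, nsmul_eq_mul,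
    ← ENNReal.ofReal_natCast, ← ENNReal.ofReal_add (by positivity) (by positivity),
    ← ENNReal.ofReal_add (by positivity) (by positivity), ← ENNReal.ofReal_mul (by positivity),
    ← ENNReal.ofReal_add (by positivity) (by positivity), ← ENNReal.ofReal_mul (by positivity)]
  congr 1
  ring

theorem frontier_cube_subset {m : ℕ} {r : ℝ} {c : Fin m → ℝ} {x : Euc m}
    (hx : x ∈ frontier (cube m r c)) : x ∈ cube m r c ∧
      ∃ i, x i = r * c i ∨ x i = r * (c i + 1) := by
  have hcube : cube m r c = ⋂ i, {x : Euc m | x i ∈ Icc (r * c i) (r * (c i + 1))} := by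
    ext x; simp [cube]
  have hclosed : IsClosed (cube m r c) := by
    rw [hcube]
    exact isClosed_iInter fun i => isClosed_Icc.preimage (by fun_prop)
  rw [hclosed.frontier_eq] at hx
  refine ⟨hx.1, ?_⟩
  by_contra! hne
  apply hx.2
  have hopen : IsOpen (⋂ i, {x : Euc m | x i ∈ Ioo (r * c i) (r * (c i + 1))}) :=
    isOpen_iInter_of_finite fun i => isOpen_Ioo.preimage (by fun_prop)
  refine mem_interior.2 ⟨_, ?_, hopen, ?_⟩
  · rw [hcube]
    exact iInter_mono fun i x hx => Ioo_subset_Icc_self hx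
  · refine mem_iInter.2 fun i => ?_
    exact ⟨lt_of_le_of_ne (hx.1 i).1 (hne i).1.symm, lt_of_le_of_ne (hx.1 i).2 (hne i).2⟩

theorem ofReal_inv_pow_le_boundaryKernel {m : ℕ} (hm : 1 ≤ m) {lam r : ℝ} (hlam : 2 ≤ lam)
    (hr : 0 < r) {c : Fin m → ℝ} {x : Euc m × ℝ}
    (hx : x ∈ frontier (cube m r c ×ˢ Icc (r / (lam - 1)) (r * lam / (lam - 1))))
    {y z : Euc m} (hy : y ∈ ball x.1 x.2) (hz : z ∈ ball x.1 x.2) (hyz : y ≠ z) :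
    ENNReal.ofReal ((x.2 ^ (2 * m))⁻¹) ≤ boundaryKernel lam r c y z := by
  obtain ⟨x, t⟩ := x
  simp only at hy hz hx ⊢
  have h1 : 0 < lam - 1 := by linarith
  have hle : r / (lam - 1) ≤ r * lam / (lam - 1) := by
    gcongr
    nlinarith
  have htop : r * lam / (lam - 1) ≤ 2 * r := by
    rw [div_le_iff₀ h1]; nlinarith
  have hclosed : IsClosed (cube m r c) := by
    have : cube m r c = ⋂ i, {x : Euc m | x i ∈ Icc (r * c i) (r * (c i + 1))} := by
      ext x; simp [cube]
    rw [this]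
    exact isClosed_iInter fun i => isClosed_Icc.preimage (by fun_prop)
  have hmem := (hclosed.prod isClosed_Icc).frontier_subset hx
  have hxc : x ∈ cube m r c := hmem.1
  have ht : t ∈ Icc (r / (lam - 1)) (r * lam / (lam - 1)) := hmem.2
  have ht0 : 0 < t := lt_of_lt_of_le (by positivity) ht.1
  have ht2 : t ≤ 2 * r := ht.2.trans htop
  have hρ : 0 < dist y z := dist_pos.2 hyz
  have hρt : dist y z < 2 * t := by
    have := dist_triangle_right y z x
    rw [mem_ball] at hy hz
    linarith
  have hcoord : ∀ l, |y l - x l| < t := fun l => by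
    have h := PiLp.norm_apply_le (y - x) l
    rw [← dist_eq_norm] at h
    exact lt_of_le_of_lt h hy
  have hbox : ∀ l, |y l - r * c l| ≤ 3 * r := fun l => by
    have h2 := abs_lt.1 (hcoord l)
    have h3 := hxc l
    rw [mem_Icc] at h3
    rw [abs_le]
    constructor <;> nlinarith
  have hlat : ∀ i e, x i = r * (c i + e) →
      ENNReal.ofReal ((t ^ (2 * m))⁻¹) ≤ lateralKernel i e r c y z := by
    intro i e hxe
    rw [lateralKernel_of_mem ⟨by linarith, hbox⟩]
    refine ENNReal.ofReal_le_ofReal ?_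
    have hpow : t ^ (2 * m) = t ^ (2 * (m - 1)) * t ^ 2 := by
      rw [← pow_add]; congr 1; omega
    rw [hpow, mul_inv, ← inv_pow]
    have hd : (y i - r * (c i + e)) ^ 2 ≤ t ^ 2 := by
      rw [← hxe]
      exact sq_le_sq.2 ((hcoord i).le.trans (le_abs_self t))
    gcongr
    · rw [inv_eq_one_div, div_le_div_iff₀ ht0 hρ]
      linarith
    · rw [inv_eq_one_div, div_le_div_iff₀ (by positivity) (by positivity)]
      nlinarith
  have hhor : ∀ a, t = a * r →
      ENNReal.ofReal ((t ^ (2 * m))⁻¹) ≤ horizontalKernel a r c y z := by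
    intro a hta
    rw [horizontalKernel_of_mem ⟨by rwa [← hta], hbox⟩, ← hta]
  rw [frontier_prod_eq, frontier_Icc hle] at hx
  unfold boundaryKernel
  rcases hx with ⟨-, hx⟩ | ⟨hx, -⟩
  · refine le_trans ?_ le_self_add
    rcases hx with hx | hx
    · exact (hhor _ (by rw [show t = _ from hx]; ring)).trans le_self_add
    · exact (hhor _ (by rw [show t = _ from hx]; ring)).trans le_add_self
  · obtain ⟨-, i, hi⟩ := frontier_cube_subset hx
    refine le_trans ?_ le_add_self
    refine le_trans ?_ (Finset.single_le_sum (f := fun i =>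
      lateralKernel i 0 r c y z + lateralKernel i 1 r c y z) (fun _ _ => zero_le)
      (Finset.mem_univ i))
    rcases hi with hi | hi
    · exact (hlat i 0 (by rw [add_zero, hi])).trans le_self_add
    · exact (hlat i 1 hi).trans le_add_self

/-- Integrating the periodization of `f` over a unit cell gives the integral of `f`. -/
theorem lintegral_Icc_tsum_int_add {m : ℕ} (f : (Fin m → ℝ) → ℝ≥0∞) (hf : Measurable f) :
    ∫⁻ h in Icc (0 : Fin m → ℝ) 1, ∑' j : Fin m → ℤ, f (fun i => (j i : ℝ) + h i)
      = ∫⁻ c, f c := by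
  let S : (Fin m → ℤ) → Set (Fin m → ℝ) := fun j =>
    Set.pi univ fun i => Ico (j i : ℝ) (j i + 1)
  have hS : ∀ j, MeasurableSet (S j) := fun j => MeasurableSet.univ_pi fun i => measurableSet_Ico
  have hmem : ∀ j c, c ∈ S j ↔ ∀ i, ⌊c i⌋ = j i := fun j c => by
    simp only [S, mem_univ_pi, mem_Ico, Int.floor_eq_iff]
  have hdisj : Pairwise (Function.onFun Disjoint S) := by
    intro j j' hjj'
    refine Set.disjoint_left.2 fun c hc hc' => hjj' (funext fun i => ?_)
    rw [← (hmem j c).1 hc i, (hmem j' c).1 hc' i]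
  have hcover : ⋃ j, S j = univ :=
    eq_univ_of_forall fun c => mem_iUnion.2 ⟨fun i => ⌊c i⌋, (hmem _ _).2 fun i => rfl⟩
  have hcell : (Icc (0 : Fin m → ℝ) 1 : Set (Fin m → ℝ)) =ᵐ[volume] S 0 := by
    have h := (Measure.univ_pi_Ico_ae_eq_Icc (μ := fun _ : Fin m => (volume : Measure ℝ))
      (f := 0) (g := 1)).symm
    rw [← volume_pi] at h
    refine h.trans (Filter.EventuallyEq.of_eq ?_)
    ext c
    simp [S]
  have hfj : ∀ j : Fin m → ℤ, Measurable fun h : Fin m → ℝ => f fun i => (j i : ℝ) + h i :=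
    fun j => hf.comp (measurable_pi_lambda _ fun i => (measurable_pi_apply i).const_add _)
  rw [setLIntegral_congr hcell, lintegral_tsum fun j => (hfj j).aemeasurable,
    ← setLIntegral_univ f, ← hcover, lintegral_iUnion hS hdisj]
  refine tsum_congr fun j => ?_
  rw [← lintegral_indicator (hS 0), ← lintegral_indicator (hS j),
    ← lintegral_add_left_eq_self ((S j).indicator f) fun i => (j i : ℝ)]
  refine lintegral_congr fun h => ?_
  have hiff : h ∈ S 0 ↔ (fun i => (j i : ℝ)) + h ∈ S j := by
    simp [hmem]
  by_cases hh : h ∈ S 0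
  · rw [indicator_of_mem hh, indicator_of_mem (hiff.1 hh)]
    rfl
  · rw [indicator_of_notMem hh, indicator_of_notMem (fun h' => hh (hiff.2 h'))]

/-- Multiplicative unfolding: the scales `τ * lam ^ (-k)` with `τ ∈ (1, lam]` and `k ∈ ℤ` cover
the half-line exactly once. -/
theorem lintegral_Ioc_tsum_zpow {lam : ℝ} (hlam : 1 < lam) (H : ℝ → ℝ≥0∞) (hH : Measurable H) :
    ∫⁻ τ in Ioc 1 lam, (∑' k : ℤ, H (τ * lam ^ (-k))) * ENNReal.ofReal τ⁻¹
      = ∫⁻ r in Ioi (0 : ℝ), H r * ENNReal.ofReal r⁻¹ := by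
  have h0 : 0 < lam := by linarith
  let S : ℤ → Set ℝ := fun k => Ioc (lam ^ (-k)) (lam ^ (-k + 1))
  have hS : ∀ k, MeasurableSet (S k) := fun k => measurableSet_Ioc
  have hdisj : Pairwise (Function.onFun Disjoint S) := by
    intro j k hjk
    refine Set.disjoint_left.2 fun x hx hx' => hjk ?_
    have h1 := (zpow_lt_zpow_iff_right₀ hlam).1 (hx.1.trans_le hx'.2)
    have h2 := (zpow_lt_zpow_iff_right₀ hlam).1 (hx'.1.trans_le hx.2)
    omega
  have hcover : ⋃ k, S k = Ioi 0 := by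
    ext x
    simp only [S, mem_iUnion, mem_Ioi]
    constructor
    · rintro ⟨k, hk⟩
      exact (zpow_pos h0 _).trans hk.1
    · intro hx
      obtain ⟨n, hn⟩ := exists_mem_Ioc_zpow hx hlam
      exact ⟨-n, by rwa [neg_neg]⟩
  simp_rw [← ENNReal.tsum_mul_right]
  rw [lintegral_tsum fun k => (by fun_prop), ← hcover, lintegral_iUnion hS hdisj]
  refine tsum_congr fun k => ?_
  have hk : 0 < lam ^ (-k) := zpow_pos h0 _
  set b := lam ^ (-k) with hb
  have hmul : ∀ g : ℝ → ℝ≥0∞, Measurable g →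
      ∫⁻ x, g x = ENNReal.ofReal b * ∫⁻ τ, g (τ * b) := by
    intro g hg
    conv_lhs => rw [← Real.smul_map_volume_mul_right hk.ne', lintegral_smul_measure,
      abs_of_pos hk, lintegral_map hg (measurable_mul_const b), smul_eq_mul]
  rw [← lintegral_indicator measurableSet_Ioc, ← lintegral_indicator (hS k),
    hmul _ (Measurable.indicator (by fun_prop) (hS k)),
    ← lintegral_const_mul _ (by
      exact (Measurable.indicator (f := fun r => H r * ENNReal.ofReal r⁻¹)
        (by fun_prop) (hS k)).comp (measurable_mul_const b))]
  refine lintegral_congr fun τ => ?_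
  have hiff : τ ∈ Ioc 1 lam ↔ τ * b ∈ S k := by
    simp only [S, mem_Ioc, zpow_add_one₀ h0.ne', ← hb]
    rw [lt_mul_iff_one_lt_left hk, mul_comm b, mul_le_mul_iff_left₀ hk]
  by_cases hτ : τ ∈ Ioc 1 lam
  · rw [indicator_of_mem hτ, indicator_of_mem (hiff.1 hτ), mul_left_comm,
      ← ENNReal.ofReal_mul hk.le, mul_inv]
    congr 2
    have := hk.ne'
    field_simp
  · rw [indicator_of_notMem hτ, indicator_of_notMem (fun h' => hτ (hiff.2 h')), mul_zero]

theorem cubeQ_eq {m : ℕ} {lam τ : ℝ} (hlam : 0 < lam) (k : ℤ) (c : Fin m → ℝ) :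
    cubeQ m lam τ k c = cube m (τ * lam ^ (-k)) c ×ˢ
      Icc (τ * lam ^ (-k) / (lam - 1)) (τ * lam ^ (-k) * lam / (lam - 1)) := by
  have : lam ^ (-(k - 1)) = lam ^ (-k) * lam := by
    rw [← zpow_add_one₀ hlam.ne']
    congr 1
    ring
  rw [cubeQ, this, mul_assoc]

/-- Tonelli's theorem turns the average over all cubes into a Gagliardo-type double integral. -/
theorem lintegral_average_boundaryKernel_le {m : ℕ} (hm : 1 ≤ m) {lam : ℝ} (hlam : 2 ≤ lam)
    (F : Euc m × Euc m → ℝ≥0∞) (hF : Measurable F) (hFdiag : ∀ y, F (y, y) = 0) (a : ℝ≥0∞) :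
    ∫⁻ r in Ioi (0 : ℝ), (∫⁻ c : Fin m → ℝ,
        a * ∫⁻ X : Euc m × Euc m, F X * boundaryKernel lam r c X.1 X.2) * ENNReal.ofReal r⁻¹
      ≤ a * ∫⁻ X : Euc m × Euc m, ENNReal.ofReal (2 * (6 ^ m * 4 ^ m) +
            2 * m * (20 * Real.pi * 6 ^ (m - 1) * 2 ^ (2 * (m - 1)))) *
          (F X / ENNReal.ofReal (dist X.1 X.2 ^ (2 * m))) := by
  have hFK : Measurable fun Z : (ℝ × (Fin m → ℝ)) × Euc m × Euc m =>
      F Z.2 * boundaryKernel lam Z.1.1 Z.1.2 Z.2.1 Z.2.2 :=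
    (hF.comp measurable_snd).mul (measurable_boundaryKernel lam)
  have hw : Measurable fun r : ℝ => ENNReal.ofReal r⁻¹ := measurable_inv.ennreal_ofReal
  have hFKw : Measurable fun Z : (ℝ × (Fin m → ℝ)) × Euc m × Euc m =>
      F Z.2 * boundaryKernel lam Z.1.1 Z.1.2 Z.2.1 Z.2.2 * ENNReal.ofReal Z.1.1⁻¹ :=
    hFK.mul (hw.comp (measurable_fst.comp measurable_fst))
  let I : ℝ × (Fin m → ℝ) → ℝ≥0∞ := fun P =>
    ∫⁻ X : Euc m × Euc m, F X * boundaryKernel lam P.1 P.2 X.1 X.2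
  have hI : Measurable I := hFK.lintegral_prod_right'
  have hIw : ∀ P, I P * ENNReal.ofReal P.1⁻¹ = ∫⁻ X : Euc m × Euc m,
      F X * boundaryKernel lam P.1 P.2 X.1 X.2 * ENNReal.ofReal P.1⁻¹ := fun P =>
    (lintegral_mul_const _ (hFK.comp (measurable_prodMk_left (x := P)))).symm
  calc _ = ∫⁻ r in Ioi (0 : ℝ), ∫⁻ c : Fin m → ℝ, a * (I (r, c) * ENNReal.ofReal r⁻¹) := by
        refine lintegral_congr fun r => ?_
        rw [← lintegral_mul_const _ (by
          exact (hI.comp (measurable_prodMk_left (x := r))).const_mul a)]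
        exact lintegral_congr fun c => mul_assoc _ _ _
    _ = a * ∫⁻ P, I P * ENNReal.ofReal P.1⁻¹
        ∂((volume.restrict (Ioi (0 : ℝ))).prod (volume : Measure (Fin m → ℝ))) := by
        have hIm : Measurable fun P : ℝ × (Fin m → ℝ) => I P * ENNReal.ofReal P.1⁻¹ :=
          hI.mul (hw.comp measurable_fst)
        rw [← lintegral_const_mul _ hIm, lintegral_prod _ (hIm.const_mul a).aemeasurable]
    _ = a * ∫⁻ X : Euc m × Euc m, F X *
          ∫⁻ P, boundaryKernel lam P.1 P.2 X.1 X.2 * ENNReal.ofReal P.1⁻¹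
          ∂((volume.restrict (Ioi (0 : ℝ))).prod (volume : Measure (Fin m → ℝ))) := by
        congr 1
        rw [lintegral_congr hIw, lintegral_lintegral_swap hFKw.aemeasurable]
        refine lintegral_congr fun X => ?_
        rw [← lintegral_const_mul _ (by
          exact ((measurable_boundaryKernel lam).comp
            (measurable_prodMk_right (y := X))).mul (hw.comp measurable_fst))]
        exact lintegral_congr fun P => mul_assoc _ _ _
    _ ≤ _ := by
        refine mul_le_mul_right (lintegral_mono ?_) a
        rintro ⟨y, z⟩
        rcases eq_or_ne y z with rfl | hyz
        · simp only [hFdiag, zero_mul]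
          exact zero_le
        · refine (mul_le_mul_right (lintegral_boundaryKernel_le hm hlam hyz) _).trans
            (le_of_eq ?_)
          have : 0 < dist y z := dist_pos.2 hyz
          rw [ENNReal.ofReal_inv_of_pos (by positivity)]
          exact mul_left_comm _ _ _

/-- Proposition 3.1: average count of bad cubes by the truncated Gagliardo energy. -/
theorem average_count_bad_cubes (m : ℕ) (hm : 1 ≤ m)
    (φ : Euc m → ℝ) (hφ : ContDiff ℝ (⊤ : ℕ∞) φ)
    (hφsupp : tsupport φ ⊆ ball (0 : Euc m) 1) (hφint : ∫ z, φ z = 1) :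
    ∃ η : ℝ, η ∈ Ioo (0 : ℝ) 1 ∧ ∃ C : ℝ, 0 < C ∧
      ∀ (ν : ℕ), 1 ≤ ν →
      ∀ (δ : ℝ), 0 < δ →
      ∀ (lam : ℝ), 2 ≤ lam →
      ∀ (Y : Set (Euc ν)), Y.Nonempty →
      ∀ (u : Euc m → Euc ν), Measurable u → (∃ M : ℝ, ∀ x, ‖u x‖ ≤ M) →
        (∀ᵐ x, u x ∈ Y) →
      (∫⁻ τ in Ioc (1 : ℝ) lam,
        (∑' k : ℤ, ∫⁻ h in Icc (0 : Fin m → ℝ) 1,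
          ∑' j : Fin m → ℤ,
            Set.indicator
              {j' : Fin m → ℤ | ENNReal.ofReal δ ≤
                ⨆ x ∈ frontier (cubeQ m lam τ k (fun i => (j' i : ℝ) + h i)),
                  ENNReal.ofReal (Metric.infDist (avgExt φ u x) Y)}
              (fun _ => (1 : ℝ≥0∞)) j)
          * ENNReal.ofReal τ⁻¹)
      ≤ ENNReal.ofReal (C / δ ^ (m + 1)) * truncGagliardo ((m : ℝ) + 1) (η * δ) u := by

  have hφc : Continuous φ := hφ.continuous
  have hcomp : HasCompactSupport φ :=
    (isCompact_closedBall (0 : Euc m) 1).of_isClosed_subset (isClosed_tsupport φ)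
      (hφsupp.trans ball_subset_closedBall)
  have hφi : Integrable φ := hφc.integrable_of_hasCompactSupport hcomp
  obtain ⟨A₀, hA₀⟩ := hcomp.exists_bound_of_continuous hφc
  have hA : ∀ z, |φ z| ≤ max A₀ 1 := fun z => (hA₀ z).trans (le_max_left _ _)
  have hApos : 0 < max A₀ 1 := lt_max_of_lt_right one_pos
  obtain ⟨η, hη, C₁, hC₁, hosc⟩ := exists_oscillation_bound hφi hApos hA hφsupp hφint
  have hpi := Real.pi_pos
  set C₂ : ℝ := 2 * (6 ^ m * 4 ^ m) + 2 * m * (20 * Real.pi * 6 ^ (m - 1) * 2 ^ (2 * (m - 1)))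
    with hC₂
  have hC₂pos : 0 < C₂ := by positivity
  refine ⟨η, hη, C₁ * C₂, by positivity, ?_⟩
  intro ν _ δ hδ lam hlam Y _ u hu hM hY
  have hlam0 : 0 < lam := by linarith
  set F : Euc m × Euc m → ℝ≥0∞ := fun X =>
    ENNReal.ofReal (max (dist (u X.1) (u X.2) - η * δ) 0 ^ ((m : ℝ) + 1)) with hFdef
  have hF : Measurable F := by fun_prop
  have hFdiag : ∀ y, F (y, y) = 0 := fun y => by
    have h1 : max (dist (u y) (u y) - η * δ) 0 = 0 := by
      rw [dist_self, max_eq_right]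
      have := mul_pos hη.1 hδ
      linarith
    simp only [hFdef, h1]
    rw [Real.zero_rpow (by positivity), ENNReal.ofReal_zero]
  let G : ℝ × (Fin m → ℝ) → ℝ≥0∞ := fun P =>
    ENNReal.ofReal (C₁ / δ ^ (m + 1)) * ∫⁻ X, F X * boundaryKernel lam P.1 P.2 X.1 X.2
  have hFK : Measurable fun Z : (ℝ × (Fin m → ℝ)) × Euc m × Euc m =>
      F Z.2 * boundaryKernel lam Z.1.1 Z.1.2 Z.2.1 Z.2.2 :=
    (hF.comp measurable_snd).mul (measurable_boundaryKernel lam)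
  have hG : Measurable G := hFK.lintegral_prod_right'.const_mul _
  have hbad : ∀ τ ∈ Ioc 1 lam, ∀ (k : ℤ) (c : Fin m → ℝ),
      ENNReal.ofReal δ ≤ ⨆ x ∈ frontier (cubeQ m lam τ k c),
        ENNReal.ofReal (Metric.infDist (avgExt φ u x) Y) → 1 ≤ G (τ * lam ^ (-k), c) := by
    intro τ hτ k c hsup
    have hr : 0 < τ * lam ^ (-k) := mul_pos (by linarith [hτ.1]) (zpow_pos hlam0 _)
    have hlt : ENNReal.ofReal (δ / 2) < ⨆ x ∈ frontier (cubeQ m lam τ k c),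
        ENNReal.ofReal (Metric.infDist (avgExt φ u x) Y) :=
      lt_of_lt_of_le ((ENNReal.ofReal_lt_ofReal_iff hδ).2 (by linarith)) hsup
    simp only [lt_iSup_iff] at hlt
    obtain ⟨⟨x, t⟩, hx, hxδ⟩ := hlt
    have hxδ' := (ENNReal.ofReal_lt_ofReal_iff_of_nonneg (by positivity)).1 hxδ
    rw [cubeQ_eq hlam0] at hx
    have h1 : 0 < lam - 1 := by linarith
    have ht : 0 < t := by
      rw [frontier_prod_eq, isClosed_Icc.closure_eq] at hx
      have : t ∈ Icc (τ * lam ^ (-k) / (lam - 1)) (τ * lam ^ (-k) * lam / (lam - 1)) := by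
        rcases hx with hx | hx
        · exact isClosed_Icc.frontier_subset hx.2
        · exact hx.2
      exact lt_of_lt_of_le (by positivity) this.1
    have key := hosc ν δ hδ Y u hu hM hY x t ht hxδ'
    have hint : ENNReal.ofReal ((t ^ (2 * m))⁻¹) *
        ∫⁻ y in ball x t, ∫⁻ z in ball x t,
            ENNReal.ofReal (max (dist (u y) (u z) - η * δ) 0 ^ ((m : ℝ) + 1))
        ≤ ∫⁻ X, F X * boundaryKernel lam (τ * lam ^ (-k)) c X.1 X.2 := by
      have hprod : ∫⁻ y in ball x t, ∫⁻ z in ball x t, F (y, z)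
          = ∫⁻ X in ball x t ×ˢ ball x t, F X := by
        rw [Measure.volume_eq_prod, setLIntegral_prod _ hF.aemeasurable]
      change _ * ∫⁻ y in ball x t, ∫⁻ z in ball x t, F (y, z) ≤ _
      rw [hprod, ← lintegral_indicator (measurableSet_ball.prod measurableSet_ball),
        ← lintegral_const_mul _ (hF.indicator (measurableSet_ball.prod measurableSet_ball))]
      refine lintegral_mono fun X => ?_
      by_cases hX : X ∈ ball x t ×ˢ ball x t
      · rw [indicator_of_mem hX]
        obtain ⟨y, z⟩ := X
        rcases eq_or_ne y z with rfl | hyz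
        · rw [hFdiag, mul_zero, zero_mul]
        · rw [mul_comm]
          gcongr
          exact ofReal_inv_pow_le_boundaryKernel hm hlam hr hx hX.1 hX.2 hyz
      · rw [indicator_of_notMem hX, mul_zero]
        exact zero_le
    calc (1 : ℝ≥0∞) = ENNReal.ofReal ((δ ^ (m + 1))⁻¹) * ENNReal.ofReal (δ ^ (m + 1)) := by
          rw [← ENNReal.ofReal_mul (by positivity), inv_mul_cancel₀ (by positivity),
            ENNReal.ofReal_one]
      _ ≤ ENNReal.ofReal ((δ ^ (m + 1))⁻¹) * (ENNReal.ofReal C₁ *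
            ∫⁻ X, F X * boundaryKernel lam (τ * lam ^ (-k)) c X.1 X.2) := by
          gcongr
          exact key.trans (by gcongr)
      _ = _ := by
          rw [← mul_assoc, ← ENNReal.ofReal_mul (by positivity), inv_mul_eq_div]
  let H : ℝ → ℝ≥0∞ := fun r => ∫⁻ c, G (r, c)
  have hH : Measurable H := hG.lintegral_prod_right'
  calc _ ≤ ∫⁻ τ in Ioc (1 : ℝ) lam,
        (∑' k : ℤ, H (τ * lam ^ (-k))) * ENNReal.ofReal τ⁻¹ := by
        refine setLIntegral_mono' measurableSet_Ioc fun τ hτ => ?_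
        gcongr with k
        refine le_of_le_of_eq ?_ (lintegral_Icc_tsum_int_add (fun c => G (τ * lam ^ (-k), c))
          (hG.comp measurable_prodMk_left))
        refine lintegral_mono fun h => ENNReal.tsum_le_tsum fun j => ?_
        exact indicator_apply_le' (fun hj => hbad τ hτ k _ hj) fun _ => zero_le
    _ = ∫⁻ r in Ioi (0 : ℝ), H r * ENNReal.ofReal r⁻¹ :=
        lintegral_Ioc_tsum_zpow (by linarith) H hH
    _ ≤ ENNReal.ofReal (C₁ / δ ^ (m + 1)) * ∫⁻ X, ENNReal.ofReal C₂ *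
          (F X / ENNReal.ofReal (dist X.1 X.2 ^ (2 * m))) :=
        lintegral_average_boundaryKernel_le hm hlam F hF hFdiag _
    _ = _ := by
        have hFq : Measurable fun X : Euc m × Euc m =>
            F X / ENNReal.ofReal (dist X.1 X.2 ^ (2 * m)) := by fun_prop
        rw [lintegral_const_mul _ hFq, ← mul_assoc, ← ENNReal.ofReal_mul (by positivity),
          Measure.volume_eq_prod, lintegral_prod _ hFq.aemeasurable, truncGagliardo,
          div_mul_eq_mul_div]
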